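/- arXiv:quant-ph/9807077 — 6 statements merged into one kernel-verified Lean document; each statement's English description precedes it below -/
import Mathlib

section
/- Let A be an n×n complex Hermitian matrix with eigenvalues λ_1, …, λ_n (listed with multiplicity), let f : ℝ → ℝ be a concave function, and let v_1, …, v_n be an orthonormal basis of ℂ^n. Then ∑_{k=1}^n f(⟨v_k, A v_k⟩) ≥ ∑_{k=1}^n f(λ_k), where each inner product ⟨v_k, A v_k⟩ is real because A is Hermitian. -/
open Matrix BigOperators

/-- The matrix of squared absolute values of the entries of a unitary matrix is doubly
stochastic. -/
lemma Matrix.map_normSq_mem_doublyStochastic {n : Type*} [Fintype n] [DecidableEq n]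
    {W : Matrix n n ℂ} (hW : W ∈ unitaryGroup n ℂ) :
    W.map Complex.normSq ∈ doublyStochastic ℝ n := by
  refine mem_doublyStochastic_iff_sum.2 ⟨fun i j => Complex.normSq_nonneg _, fun i => ?_,
    fun j => ?_⟩
  · have h := congrFun₂ (mem_unitaryGroup_iff.1 hW) i i
    simp only [mul_apply, star_apply, one_apply_eq, Complex.star_def, Complex.mul_conj] at h
    exact_mod_cast h
  · have h := congrFun₂ (mem_unitaryGroup_iff'.1 hW) j j
    simp only [mul_apply, star_apply, one_apply_eq, Complex.star_def,
      ← Complex.normSq_eq_conj_mul_self] at h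
    exact_mod_cast h

/-- The quadratic form of a Hermitian matrix in terms of the coordinates of a vector in an
eigenbasis. -/
lemma Matrix.IsHermitian.re_star_dotProduct_mulVec {n : Type*} [Fintype n] [DecidableEq n]
    {A : Matrix n n ℂ} (hA : A.IsHermitian) (x : n → ℂ) :
    (star x ⬝ᵥ A *ᵥ x).re =
      ∑ j, Complex.normSq ((star (hA.eigenvectorUnitary : Matrix n n ℂ) *ᵥ x) j) *
        hA.eigenvalues j := by
  set U := hA.eigenvectorUnitary.val
  have hspec : A = U * diagonal (RCLike.ofReal ∘ hA.eigenvalues) * star U :=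
    hA.spectral_theorem.trans (Unitary.conjStarAlgAut_apply _ _)
  have hx : star x ᵥ* U = star (star U *ᵥ x) := by
    rw [star_mulVec, star_eq_conjTranspose, conjTranspose_conjTranspose]
  conv_lhs => rw [hspec]
  rw [← mulVec_mulVec, ← mulVec_mulVec, dotProduct_mulVec, hx]
  simp only [dotProduct, Complex.re_sum, mulVec_diagonal, Pi.star_apply]
  refine Finset.sum_congr rfl fun j _ => ?_
  simp [Complex.normSq_apply]
  ring

/-- A concave function has a larger sum over the image of a vector under a doubly stochastic
matrix, acting from the right, than over the vector itself. -/
lemma ConcaveOn.sum_le_sum_vecMul_of_mem_doublyStochastic {n : Type*} [Fintype n]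
    [DecidableEq n] {f : ℝ → ℝ} (hf : ConcaveOn ℝ Set.univ f) {M : Matrix n n ℝ}
    (hM : M ∈ doublyStochastic ℝ n) (x : n → ℝ) :
    ∑ j, f (x j) ≤ ∑ k, f (∑ j, M j k * x j) :=
  calc
    ∑ j, f (x j) = ∑ j, (∑ k, M j k) * f (x j) := by
      simp [sum_row_of_mem_doublyStochastic hM]
    _ = ∑ k, ∑ j, M j k * f (x j) := by
      simp_rw [Finset.sum_mul]
      exact Finset.sum_comm
    _ ≤ ∑ k, f (∑ j, M j k * x j) :=
      Finset.sum_le_sum fun k _ => hf.le_map_sum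
        (fun _ _ => nonneg_of_mem_doublyStochastic hM) (sum_col_of_mem_doublyStochastic hM k)
        fun _ _ => Set.mem_univ _

/-- For an `n×n` Hermitian matrix `A` with eigenvalues `λ_1, …, λ_n` (with multiplicity),
a concave function `f : ℝ → ℝ`, and any orthonormal basis of `ℂ^n` (encoded as the rows
`v k` of a unitary matrix `v`), we have `∑ f(⟨v_k, A v_k⟩) ≥ ∑ f(λ_k)`. -/
theorem eigenbasis_minimizes_concave_sum
    (n : ℕ) (A : Matrix (Fin n) (Fin n) ℂ) (hA : A.IsHermitian)
    (f : ℝ → ℝ) (hf : ConcaveOn ℝ Set.univ f)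
    (v : Matrix (Fin n) (Fin n) ℂ) (hv : v ∈ Matrix.unitaryGroup (Fin n) ℂ) :
    ∑ k, f ((star (v k) ⬝ᵥ A *ᵥ v k).re) ≥ ∑ k, f (hA.eigenvalues k) := by
  have hW := mul_mem (Unitary.star_mem hA.eigenvectorUnitary.2)
    (transpose_mem_unitaryGroup_iff.2 hv)
  refine (hf.sum_le_sum_vecMul_of_mem_doublyStochastic
    (map_normSq_mem_doublyStochastic hW) hA.eigenvalues).trans_eq ?_
  simp_rw [hA.re_star_dotProduct_mulVec]
  rfl
end

section
/- Let ρ be an n×n complex density matrix (positive semidefinite with trace 1) with eigenvalues λ_1, …, λ_n, and let α ∈ (0,1). Then for every orthonormal basis v_1, …, v_n of ℂ^n one has ∑_{k=1}^n (⟨v_k, ρ v_k⟩)^α ≥ ∑_{k=1}^n λ_k^α, and equality holds when v_1, …, v_n is an orthonormal eigenbasis of ρ. Consequently the minimum over all complete von Neumann measurements of the Rényi entropy S_α of the outcome probability distribution {⟨v_k, ρ v_k⟩} equals (1/(1−α))·log₂(∑_k λ_k^α). -/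
open Matrix BigOperators ComplexOrder

namespace Matrix

variable {ι : Type*} [Fintype ι] [DecidableEq ι]

/-- The rows of a unitary matrix are unit vectors. -/
lemma sum_normSq_row_of_mem_unitaryGroup {v : Matrix ι ι ℂ} (hv : v ∈ unitaryGroup ι ℂ) (k : ι) :
    ∑ j, Complex.normSq (v k j) = 1 := by
  have h := congrFun (congrFun (mem_unitaryGroup_iff.mp hv) k) k
  simp only [mul_apply, star_apply, RCLike.star_def, Complex.mul_conj, one_apply_eq] at h
  exact_mod_cast h

/-- The columns of a unitary matrix are unit vectors. -/
lemma sum_normSq_col_of_mem_unitaryGroup {v : Matrix ι ι ℂ} (hv : v ∈ unitaryGroup ι ℂ) (j : ι) :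
    ∑ k, Complex.normSq (v k j) = 1 :=
  sum_normSq_row_of_mem_unitaryGroup (transpose_mem_unitaryGroup_iff.mpr hv) j

lemma star_row_dotProduct_row_of_mem_unitaryGroup {v : Matrix ι ι ℂ} (hv : v ∈ unitaryGroup ι ℂ)
    (k : ι) : star (v k) ⬝ᵥ v k = 1 := by
  have h := congrFun (congrFun (mem_unitaryGroup_iff.mp hv) k) k
  rw [dotProduct_comm]
  simpa [mul_apply, dotProduct] using h

/-- The quadratic form of a Hermitian matrix, expanded in its eigenbasis. -/
lemma IsHermitian.re_star_dotProduct_mulVec_s1 {A : Matrix ι ι ℂ} (hA : A.IsHermitian) (x : ι → ℂ) :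
    (star x ⬝ᵥ A *ᵥ x).re =
      ∑ j, Complex.normSq ((star (hA.eigenvectorUnitary : Matrix ι ι ℂ) *ᵥ x) j) *
        hA.eigenvalues j := by
  set U := (hA.eigenvectorUnitary : Matrix ι ι ℂ)
  have hspec : A = U * diagonal (RCLike.ofReal ∘ hA.eigenvalues) * star U := by
    conv_lhs => rw [hA.spectral_theorem, Unitary.conjStarAlgAut_apply]
  have hx : star x ᵥ* U = star (star U *ᵥ x) := by
    rw [star_mulVec, star_eq_conjTranspose, conjTranspose_conjTranspose]
  conv_lhs => rw [hspec]
  rw [← mulVec_mulVec, ← mulVec_mulVec, dotProduct_mulVec, hx]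
  simp only [dotProduct, mulVec_diagonal, Complex.re_sum, Pi.star_apply, Function.comp_apply]
  refine Finset.sum_congr rfl fun j _ => ?_
  rw [mul_left_comm, RCLike.star_def, ← Complex.normSq_eq_conj_mul_self]
  simp [mul_comm]

/-- Measuring a positive semidefinite matrix in any orthonormal basis (the rows of a unitary `v`)
can only increase the sum of `α`-th powers compared with the eigenvalues. -/
lemma PosSemidef.sum_eigenvalues_rpow_le {A : Matrix ι ι ℂ} (hA : A.PosSemidef)
    {v : Matrix ι ι ℂ} (hv : v ∈ unitaryGroup ι ℂ) {α : ℝ} (h₀ : 0 ≤ α) (h₁ : α ≤ 1) :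
    ∑ k, hA.1.eigenvalues k ^ α ≤ ∑ k, (star (v k) ⬝ᵥ A *ᵥ v k).re ^ α := by
  set M : Matrix ι ι ℂ := star (hA.1.eigenvectorUnitary : Matrix ι ι ℂ) * vᵀ
  have hMu : M ∈ unitaryGroup ι ℂ :=
    mul_mem (Unitary.star_mem hA.1.eigenvectorUnitary.2) (transpose_mem_unitaryGroup_iff.mpr hv)
  calc ∑ j, hA.1.eigenvalues j ^ α
      = ∑ j, (∑ k, Complex.normSq (M j k)) * hA.1.eigenvalues j ^ α := by
        simp [sum_normSq_row_of_mem_unitaryGroup hMu]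
    _ = ∑ k, ∑ j, Complex.normSq (M j k) • hA.1.eigenvalues j ^ α := by
        simp_rw [Finset.sum_mul, smul_eq_mul]
        exact Finset.sum_comm
    _ ≤ ∑ k, (∑ j, Complex.normSq (M j k) • hA.1.eigenvalues j) ^ α :=
        Finset.sum_le_sum fun k _ => (Real.concaveOn_rpow h₀ h₁).le_map_sum
          (fun _ _ => Complex.normSq_nonneg _) (sum_normSq_col_of_mem_unitaryGroup hMu k)
          (fun j _ => hA.eigenvalues_nonneg j)
    _ = ∑ k, (star (v k) ⬝ᵥ A *ᵥ v k).re ^ α := by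
        simp_rw [hA.1.re_star_dotProduct_mulVec_s1]
        rfl

/-- Measuring in an orthonormal eigenbasis yields the eigenvalues. -/
lemma re_star_dotProduct_mulVec_of_eigenvector {A v : Matrix ι ι ℂ} (hv : v ∈ unitaryGroup ι ℂ)
    {k : ι} {c : ℝ} (h : A *ᵥ v k = (c : ℂ) • v k) : (star (v k) ⬝ᵥ A *ᵥ v k).re = c := by
  rw [h, dotProduct_smul, star_row_dotProduct_row_of_mem_unitaryGroup hv]
  simp

lemma PosSemidef.sum_eigenvalues_rpow_pos {A : Matrix ι ι ℂ} (hA : A.PosSemidef)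
    (hne : A.trace ≠ 0) (α : ℝ) : 0 < ∑ k, hA.1.eigenvalues k ^ α := by
  obtain ⟨k, -, hk⟩ : ∃ k ∈ Finset.univ, (hA.1.eigenvalues k : ℂ) ≠ 0 :=
    Finset.exists_ne_zero_of_sum_ne_zero (by simpa [hA.1.trace_eq_sum_eigenvalues] using hne)
  have hk : 0 < hA.1.eigenvalues k :=
    (hA.eigenvalues_nonneg k).lt_of_ne' (by exact_mod_cast hk)
  exact Finset.sum_pos' (fun j _ => Real.rpow_nonneg (hA.eigenvalues_nonneg j) α)
    ⟨k, Finset.mem_univ k, Real.rpow_pos_of_pos hk α⟩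

end Matrix

/-- For a density matrix `ρ` with eigenvalues `λ_k` and `α ∈ (0,1)`:
(i) for every orthonormal basis (the rows `v k` of a unitary `v`),
`∑ ⟨v_k, ρ v_k⟩^α ≥ ∑ λ_k^α`;
(ii) equality holds when the `v k` form an orthonormal eigenbasis of `ρ`;
(iii) consequently the minimum over all complete von Neumann measurements of the Rényi
entropy `S_α` of the outcome distribution is `(1/(1−α))·log₂(∑ λ_k^α)`. -/
theorem renyi_entropy_minimized_by_eigenbasis
    (n : ℕ) (ρ : Matrix (Fin n) (Fin n) ℂ) (hρ : ρ.PosSemidef) (hτ : ρ.trace = 1)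
    (α : ℝ) (hα : α ∈ Set.Ioo (0 : ℝ) 1) :
    (∀ v : Matrix (Fin n) (Fin n) ℂ, v ∈ Matrix.unitaryGroup (Fin n) ℂ →
      ∑ k, ((star (v k) ⬝ᵥ ρ *ᵥ v k).re) ^ α ≥ ∑ k, (hρ.1.eigenvalues k) ^ α)
    ∧
    (∀ v : Matrix (Fin n) (Fin n) ℂ, v ∈ Matrix.unitaryGroup (Fin n) ℂ →
      (∀ k, ρ *ᵥ v k = ((hρ.1.eigenvalues k : ℝ) : ℂ) • v k) →
      ∑ k, ((star (v k) ⬝ᵥ ρ *ᵥ v k).re) ^ α = ∑ k, (hρ.1.eigenvalues k) ^ α)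
    ∧
    IsLeast
      {S : ℝ | ∃ v ∈ Matrix.unitaryGroup (Fin n) ℂ,
        S = (1 / (1 - α)) * Real.logb 2 (∑ k, ((star (v k) ⬝ᵥ ρ *ᵥ v k).re) ^ α)}
      ((1 / (1 - α)) * Real.logb 2 (∑ k, (hρ.1.eigenvalues k) ^ α)) := by
  have hle := fun (v : Matrix (Fin n) (Fin n) ℂ) (hv : v ∈ Matrix.unitaryGroup (Fin n) ℂ) =>
    hρ.sum_eigenvalues_rpow_le hv hα.1.le hα.2.le
  have heq : ∀ v : Matrix (Fin n) (Fin n) ℂ, v ∈ Matrix.unitaryGroup (Fin n) ℂ →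
      (∀ k, ρ *ᵥ v k = ((hρ.1.eigenvalues k : ℝ) : ℂ) • v k) →
      ∑ k, ((star (v k) ⬝ᵥ ρ *ᵥ v k).re) ^ α = ∑ k, (hρ.1.eigenvalues k) ^ α :=
    fun v hv h => Finset.sum_congr rfl fun k _ => by
      rw [re_star_dotProduct_mulVec_of_eigenvector hv (h k)]
  refine ⟨hle, heq, ?_, ?_⟩
  · have hU := transpose_mem_unitaryGroup_iff.mpr hρ.1.eigenvectorUnitary.2
    refine ⟨_, hU, ?_⟩
    rw [heq _ hU fun k => hρ.1.mulVec_eigenvectorBasis k]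
  · rintro _ ⟨v, hv, rfl⟩
    exact mul_le_mul_of_nonneg_left
      (Real.logb_le_logb_of_le one_lt_two
        (hρ.sum_eigenvalues_rpow_pos (by simp [hτ]) α) (hle v hv))
      (one_div_nonneg.mpr (sub_nonneg.mpr hα.2.le))
end

section
/- Let f : ℝ → ℝ be a concave function, let A and B be n×n complex Hermitian matrices, and let t ∈ [0,1]. Then ∑_{i=1}^n f(λ_i(tA + (1−t)B)) ≥ t·∑_{i=1}^n f(λ_i(A)) + (1−t)·∑_{i=1}^n f(λ_i(B)), where λ_1(X), …, λ_n(X) denote the eigenvalues of the Hermitian matrix X listed with multiplicity. In other words, σ ↦ Tr[f(σ)] is concave on Hermitian matrices. -/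
open Matrix BigOperators

/-- The quadratic form of a Hermitian matrix in terms of its eigenvalues. -/
theorem Matrix.IsHermitian.re_inner_toEuclideanLin_self {ι : Type*} [Fintype ι] [DecidableEq ι]
    {A : Matrix ι ι ℂ} (hA : A.IsHermitian) (v : EuclideanSpace ℂ ι) :
    (inner ℂ v (toEuclideanLin A v)).re =
      ∑ j, ‖inner ℂ (hA.eigenvectorBasis j) v‖ ^ 2 * hA.eigenvalues j := by
  have apply_basis (j : ι) : toEuclideanLin A (hA.eigenvectorBasis j) =
      (hA.eigenvalues j : ℂ) • hA.eigenvectorBasis j := by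
    ext k
    simpa using congrFun (hA.mulVec_eigenvectorBasis j) k
  rw [← hA.eigenvectorBasis.sum_inner_mul_inner, Complex.re_sum]
  refine Finset.sum_congr rfl fun j _ => ?_
  rw [← (isSymmetric_toEuclideanLin_iff.mpr hA) (hA.eigenvectorBasis j) v, apply_basis,
    inner_smul_left, Complex.conj_ofReal, mul_left_comm, ← inner_conj_symm v,
    Complex.conj_mul', Complex.re_ofReal_mul, mul_comm, ← Complex.ofReal_pow, Complex.ofReal_re]

/-- The eigenvalues of a Hermitian matrix as values of its quadratic form. -/
theorem Matrix.IsHermitian.re_inner_toEuclideanLin_eigenvectorBasis {ι : Type*} [Fintype ι]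
    [DecidableEq ι] {A : Matrix ι ι ℂ} (hA : A.IsHermitian) (i : ι) :
    (inner ℂ (hA.eigenvectorBasis i) (toEuclideanLin A (hA.eigenvectorBasis i))).re =
      hA.eigenvalues i := by
  simp [hA.re_inner_toEuclideanLin_self, OrthonormalBasis.inner_eq_ite, apply_ite]

/-- **Peierls' inequality**: replacing the eigenvalues of a Hermitian matrix by its diagonal entries
in an orthonormal basis does not decrease the trace of a concave function. -/
theorem ConcaveOn.sum_eigenvalues_le_sum_re_inner {ι : Type*} [Fintype ι] [DecidableEq ι]
    {f : ℝ → ℝ} (hf : ConcaveOn ℝ Set.univ f) {A : Matrix ι ι ℂ} (hA : A.IsHermitian)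
    (b : OrthonormalBasis ι ℂ (EuclideanSpace ℂ ι)) :
    ∑ i, f (hA.eigenvalues i) ≤ ∑ i, f (inner ℂ (b i) (toEuclideanLin A (b i))).re := by
  calc ∑ j, f (hA.eigenvalues j)
      = ∑ j, ∑ i, ‖inner ℂ (hA.eigenvectorBasis j) (b i)‖ ^ 2 * f (hA.eigenvalues j) := by
        simp [← Finset.sum_mul, b.sum_sq_norm_inner_left]
    _ = ∑ i, ∑ j, ‖inner ℂ (hA.eigenvectorBasis j) (b i)‖ ^ 2 * f (hA.eigenvalues j) :=
        Finset.sum_comm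
    _ ≤ ∑ i, f (inner ℂ (b i) (toEuclideanLin A (b i))).re := by
        gcongr with i
        rw [hA.re_inner_toEuclideanLin_self]
        refine hf.le_map_sum (fun _ _ => by positivity) ?_ fun _ _ => Set.mem_univ _
        simp [hA.eigenvectorBasis.sum_sq_norm_inner_right]

/-- For a concave `f : ℝ → ℝ`, Hermitian `A, B` and `t ∈ [0,1]`,
`∑ f(λ_i(tA+(1−t)B)) ≥ t·∑ f(λ_i(A)) + (1−t)·∑ f(λ_i(B))`:
`σ ↦ Tr[f(σ)]` is concave on Hermitian matrices. -/
theorem trace_concave_function_of_hermitian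
    (n : ℕ) (f : ℝ → ℝ) (hf : ConcaveOn ℝ Set.univ f)
    (A B : Matrix (Fin n) (Fin n) ℂ)
    (hA : A.IsHermitian) (hB : B.IsHermitian)
    (t : ℝ) (ht : t ∈ Set.Icc (0 : ℝ) 1) :
    ∑ i, f (Matrix.IsHermitian.eigenvalues
          (show (t • A + (1 - t) • B).IsHermitian from
            ((IsSelfAdjoint.all t).smul hA).add ((IsSelfAdjoint.all (1 - t)).smul hB))
          i)
      ≥ t * ∑ i, f (hA.eigenvalues i) + (1 - t) * ∑ i, f (hB.eigenvalues i) := by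
  generalize_proofs hC
  have eigenvalues_eq (i : Fin n) : hC.eigenvalues i =
      t * (inner ℂ (hC.eigenvectorBasis i) (toEuclideanLin A (hC.eigenvectorBasis i))).re +
      (1 - t) * (inner ℂ (hC.eigenvectorBasis i)
        (toEuclideanLin B (hC.eigenvectorBasis i))).re := by
    rw [← hC.re_inner_toEuclideanLin_eigenvectorBasis]
    generalize hC.eigenvectorBasis i = v
    rw [← Complex.coe_smul t A,
      ← Complex.coe_smul (1 - t) B, map_add, map_smul, map_smul, LinearMap.add_apply,
      LinearMap.smul_apply, LinearMap.smul_apply, inner_add_right, inner_smul_right,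
      inner_smul_right, Complex.add_re, Complex.re_ofReal_mul, Complex.re_ofReal_mul]
  have h_one_sub : 0 ≤ 1 - t := sub_nonneg.mpr ht.2
  calc t * ∑ i, f (hA.eigenvalues i) + (1 - t) * ∑ i, f (hB.eigenvalues i)
      ≤ t * ∑ i, f (inner ℂ (hC.eigenvectorBasis i)
            (toEuclideanLin A (hC.eigenvectorBasis i))).re +
          (1 - t) * ∑ i, f (inner ℂ (hC.eigenvectorBasis i)
            (toEuclideanLin B (hC.eigenvectorBasis i))).re :=
        add_le_add
          (mul_le_mul_of_nonneg_left (hf.sum_eigenvalues_le_sum_re_inner hA _) ht.1)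
          (mul_le_mul_of_nonneg_left (hf.sum_eigenvalues_le_sum_re_inner hB _) h_one_sub)
    _ ≤ ∑ i, f (hC.eigenvalues i) := by
        rw [Finset.mul_sum, Finset.mul_sum, ← Finset.sum_add_distrib]
        refine Finset.sum_le_sum fun i _ => ?_
        rw [eigenvalues_eq]
        exact hf.2 (Set.mem_univ _) (Set.mem_univ _) ht.1 h_one_sub (add_sub_cancel t 1)
end

section
/- Let p, q : {1, …, n} → ℝ be two nonnegative vectors with ∑_i p_i = ∑_i q_i = 1. If ∑_{i=1}^n p_i^α = ∑_{i=1}^n q_i^α for every α ∈ (0,1) (with the convention 0^α = 0), then there exists a permutation π of {1, …, n} such that q_i = p_{π(i)} for all i. In particular, if two probability vectors have the same Rényi entropy S_α for every α ∈ (0,1), they coincide up to a permutation of their entries. -/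
open BigOperators

theorem analyticAt_const_rpow_of_pos {x a : ℝ} (hx : 0 ≤ x) (ha : 0 < a) :
    AnalyticAt ℝ (fun t : ℝ => x ^ t) a := by
  rcases hx.eq_or_lt with rfl | hx
  · refine (analyticAt_const (v := (0 : ℝ))).congr ?_
    filter_upwards [lt_mem_nhds ha] with t ht
    rw [Real.zero_rpow ht.ne']
  · simp only [Real.rpow_def_of_pos hx]
    exact (analyticAt_const.mul analyticAt_id).rexp'

theorem sum_rpow_eq_of_eqOn_Ioo {ι : Type*} [Fintype ι] {p q : ι → ℝ}
    (hp : ∀ i, 0 ≤ p i) (hq : ∀ i, 0 ≤ q i) {b : ℝ} (hb : 0 < b)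
    (h : ∀ α ∈ Set.Ioo (0 : ℝ) b, ∑ i, p i ^ α = ∑ i, q i ^ α) {α : ℝ} (hα : 0 < α) :
    ∑ i, p i ^ α = ∑ i, q i ^ α := by
  have key {r : ι → ℝ} (hr : ∀ i, 0 ≤ r i) :
      AnalyticOnNhd ℝ (fun t : ℝ => ∑ i, r i ^ t) (Set.Ioi 0) := fun a ha =>
    Finset.analyticAt_fun_sum _ fun i _ => analyticAt_const_rpow_of_pos (hr i) ha
  refine (key hp).eqOn_of_preconnected_of_eventuallyEq (key hq) isPreconnected_Ioi
    (z₀ := b / 2) (half_pos hb) ?_ hα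
  filter_upwards [Ioo_mem_nhds (half_pos hb) (half_lt_self hb)] with t ht
  exact h t ht

theorem sum_eval_eq_of_sum_pow_eq {ι R : Type*} [Fintype ι] [CommSemiring R] {p q : ι → R}
    (h : ∀ k : ℕ, ∑ i, p i ^ k = ∑ i, q i ^ k) (P : Polynomial R) :
    ∑ i, P.eval (p i) = ∑ i, P.eval (q i) := by
  simp only [Polynomial.eval_eq_sum_range]
  rw [Finset.sum_comm, Finset.sum_comm (s := Finset.univ)]
  simp only [← Finset.mul_sum, h]

theorem exists_perm_of_sum_pow_eq {ι K : Type*} [Fintype ι] [Field K] [CharZero K] {p q : ι → K}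
    (h : ∀ k : ℕ, ∑ i, p i ^ k = ∑ i, q i ^ k) :
    ∃ π : Equiv.Perm ι, ∀ i, q i = p (π i) := by
  classical
  suffices hc : ∀ v, Nonempty ({i // q i = v} ≃ {i // p i = v}) from
    ⟨Equiv.ofFiberEquiv fun v => (hc v).some, fun i => (Equiv.ofFiberEquiv_map _ i).symm⟩
  intro v
  let s : Finset K := insert v (Finset.univ.image p ∪ Finset.univ.image q)
  have hs : v ∈ s := Finset.mem_insert_self _ _
  have basis_eval {w : K} (hw : w ∈ s) :
      (Lagrange.basis s id v).eval w = if v = w then 1 else 0 := by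
    split_ifs with hvw
    · subst hvw
      exact Lagrange.eval_basis_self (v := id) Function.injective_id.injOn hs
    · exact Lagrange.eval_basis_of_ne (v := id) hvw hw
  have hsum := sum_eval_eq_of_sum_pow_eq h (Lagrange.basis s id v)
  rw [Finset.sum_congr rfl fun i _ => basis_eval (w := p i) (by simp [s]),
    Finset.sum_congr rfl fun i _ => basis_eval (w := q i) (by simp [s]),
    Finset.sum_boole, Finset.sum_boole, Nat.cast_inj] at hsum
  refine Fintype.card_eq.1 ?_
  rw [Fintype.card_subtype, Fintype.card_subtype]
  simpa only [eq_comm] using hsum.symm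

/-- Two probability vectors with equal power sums `∑ p_i^α` for every `α ∈ (0,1)`
(with `x ^ α` being `Real.rpow`, so `0^α = 0`) coincide up to a permutation;
i.e. the Rényi entropies of all orders `α ∈ (0,1)` determine a probability vector
up to permutation of its entries. -/
theorem prob_vector_determined_by_power_sums
    (n : ℕ) (p q : Fin n → ℝ)
    (hp : ∀ i, 0 ≤ p i) (hq : ∀ i, 0 ≤ q i)
    (hps : ∑ i, p i = 1) (hqs : ∑ i, q i = 1)
    (h : ∀ α ∈ Set.Ioo (0 : ℝ) 1, ∑ i, p i ^ α = ∑ i, q i ^ α) :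
    ∃ π : Equiv.Perm (Fin n), ∀ i, q i = p (π i) := by
  refine exists_perm_of_sum_pow_eq fun k => ?_
  rcases k.eq_zero_or_pos with rfl | hk
  · simp
  · simpa using sum_rpow_eq_of_eqOn_Ioo hp hq one_pos h (Nat.cast_pos.2 hk)
end

section
/- Let M and N be n×n complex matrices such that the Hermitian matrices MᴴM and NᴴN have the same characteristic polynomial (equivalently, the same eigenvalues with multiplicity, i.e. M and N have the same singular values). Then there exist unitary matrices U and V such that N = U M V. -/
open Matrix

/-- Two endomorphisms with pointwise equal norms differ by a linear isometry on the left. -/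
theorem exists_linearIsometry_comp_eq_of_norm_eq {𝕜 E : Type*} [RCLike 𝕜]
    [NormedAddCommGroup E] [InnerProductSpace 𝕜 E] [FiniteDimensional 𝕜 E]
    (a b : E →ₗ[𝕜] E) (hab : ∀ x, ‖a x‖ = ‖b x‖) :
    ∃ u : E →ₗᵢ[𝕜] E, ∀ x, u (a x) = b x := by
  obtain ⟨g, hg⟩ := a.rangeRestrict.exists_rightInverse_of_surjective a.range_rangeRestrict
  have hag (y : LinearMap.range a) : a (g y) = y :=
    congrArg Subtype.val (LinearMap.congr_fun hg y)
  let L : LinearMap.range a →ₗᵢ[𝕜] E :=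
    ⟨b ∘ₗ g, fun y => by
      rw [LinearMap.comp_apply, ← hab, hag, Submodule.coe_norm]⟩
  refine ⟨L.extend, fun x => ?_⟩
  let y : LinearMap.range a := a.rangeRestrict x
  have hL : L.extend (a x) = b (g y) := L.extend_apply y
  rw [hL, ← sub_eq_zero, ← map_sub, ← norm_eq_zero, ← hab, map_sub, hag, norm_eq_zero,
    sub_eq_zero]
  rfl

/-- Matrices with the same Gram matrix differ by a unitary on the left. -/
theorem Matrix.exists_unitary_mul_eq_of_conjTranspose_mul_self_eq {𝕜 m : Type*} [RCLike 𝕜]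
    [Fintype m] [DecidableEq m] (A B : Matrix m m 𝕜) (hAB : Aᴴ * A = Bᴴ * B) :
    ∃ U ∈ Matrix.unitaryGroup m 𝕜, B = U * A := by
  let Φ := Matrix.toEuclideanCLM (n := m) (𝕜 := 𝕜)
  have hnorm (x) : ‖Φ A x‖ = ‖Φ B x‖ := by
    have hΦ : star (Φ A) * Φ A = star (Φ B) * Φ B := by
      rw [← map_star, ← map_star, ← map_mul, ← map_mul]
      exact congrArg Φ hAB
    have hx (C : Matrix m m 𝕜) : ‖Φ C x‖ ^ 2 = RCLike.re (inner 𝕜 ((star (Φ C) * Φ C) x) x) :=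
      (Φ C).apply_norm_sq_eq_inner_adjoint_left x
    rw [← sq_eq_sq₀ (norm_nonneg _) (norm_nonneg _), hx, hx, hΦ]
  obtain ⟨u, hu⟩ := exists_linearIsometry_comp_eq_of_norm_eq
    (Φ A).toLinearMap (Φ B).toLinearMap hnorm
  obtain ⟨U, hU⟩ := EquivLike.surjective Φ u.toContinuousLinearMap
  refine ⟨U, ?_, ?_⟩
  · rw [Matrix.mem_unitaryGroup_iff']
    apply EquivLike.injective Φ
    rw [map_mul, map_star, hU, map_one]
    exact (ContinuousLinearMap.norm_map_iff_adjoint_comp_self _).mp u.norm_map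
  · apply EquivLike.injective Φ
    rw [map_mul, hU]
    ext1 x
    exact (hu x).symm

/-- Hermitian matrices with the same characteristic polynomial are unitarily similar. -/
theorem Matrix.IsHermitian.exists_unitary_conj_eq_of_charpoly_eq {𝕜 m : Type*} [RCLike 𝕜]
    [Fintype m] [DecidableEq m] {A B : Matrix m m 𝕜} (hA : A.IsHermitian) (hB : B.IsHermitian)
    (h : A.charpoly = B.charpoly) :
    ∃ W : Matrix.unitaryGroup m 𝕜, Unitary.conjStarAlgAut 𝕜 _ W A = B := by
  refine ⟨hB.eigenvectorUnitary * star hA.eigenvectorUnitary, ?_⟩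
  rw [Unitary.conjStarAlgAut_mul_apply, hA.conjStarAlgAut_star_eigenvectorUnitary,
    (hA.eigenvalues_eq_eigenvalues_iff hB).mpr h, ← hB.spectral_theorem]

/-- If `MᴴM` and `NᴴN` have the same characteristic polynomial (i.e. `M` and `N` have the
same singular values), then `N = U M V` for some unitaries `U, V`: bipartite pure states
with identical Schmidt coefficients are related by local unitaries. -/
theorem exists_unitaries_of_same_singular_values
    (n : ℕ) (M N : Matrix (Fin n) (Fin n) ℂ)
    (h : (Mᴴ * M).charpoly = (Nᴴ * N).charpoly) :
    ∃ U V : Matrix (Fin n) (Fin n) ℂ,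
      U ∈ Matrix.unitaryGroup (Fin n) ℂ ∧ V ∈ Matrix.unitaryGroup (Fin n) ℂ ∧
      N = U * M * V := by
  obtain ⟨W, hW⟩ := (Matrix.isHermitian_conjTranspose_mul_self
    M).exists_unitary_conj_eq_of_charpoly_eq (Matrix.isHermitian_conjTranspose_mul_self N) h
  have hGram : (M * star (W : Matrix (Fin n) (Fin n) ℂ))ᴴ *
      (M * star (W : Matrix (Fin n) (Fin n) ℂ)) = Nᴴ * N := by
    rw [← hW, Unitary.conjStarAlgAut_apply]
    simp [Matrix.star_eq_conjTranspose, Matrix.mul_assoc]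
  obtain ⟨U, hU, hN⟩ := Matrix.exists_unitary_mul_eq_of_conjTranspose_mul_self_eq _ _ hGram
  exact ⟨U, star W, hU, (star W).2, by rw [hN, Matrix.mul_assoc]⟩
end

section
/- Let p ∈ (0,1), set q = 1 − p, and let x ∈ (0,1) with x > p. Then as N → ∞, (1/N) · ∑_{l=0}^{⌊xN⌋} C(N,l) p^l q^{N−l} · ( −log₂( p^l q^{N−l} ) ) converges to the binary entropy H(p) = −p log₂ p − q log₂ q, where C(N,l) is the binomial coefficient. If instead x < p, the same expression converges to 0. -/
open BigOperators Filter

/-- The binomial weights `C(N,l) p^l (1-p)^{N-l}` sum to `1`. -/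
theorem sum_binomial_weight (p : ℝ) (N : ℕ) :
    ∑ l ∈ Finset.range (N + 1), (N.choose l : ℝ) * p ^ l * (1 - p) ^ (N - l) = 1 := by
  have h := congrArg (Polynomial.eval p) (bernsteinPolynomial.sum ℝ N)
  simpa [bernsteinPolynomial, Polynomial.eval_finsetSum] using h

/-- The variance of the normalized binomial distribution. -/
theorem sum_binomial_weight_mul_sq (p : ℝ) {N : ℕ} (hN : N ≠ 0) :
    ∑ l ∈ Finset.range (N + 1),
      (N.choose l : ℝ) * p ^ l * (1 - p) ^ (N - l) * ((l : ℝ) / N - p) ^ 2 =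
      p * (1 - p) / N := by
  have h := congrArg (Polynomial.eval p) (bernsteinPolynomial.variance ℝ N)
  simp only [bernsteinPolynomial, Polynomial.eval_finsetSum, nsmul_eq_mul, Polynomial.eval_mul,
    Polynomial.eval_pow, Polynomial.eval_sub, Polynomial.eval_natCast, Polynomial.eval_X,
    Polynomial.eval_one] at h
  have hN' : (N : ℝ) ≠ 0 := Nat.cast_ne_zero.mpr hN
  have h2 : p * (1 - p) / N = (N * p * (1 - p)) / (N : ℝ) ^ 2 := by field_simp
  rw [h2, ← h, Finset.sum_div]
  refine Finset.sum_congr rfl fun l _ => ?_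
  field_simp
  ring

/-- The weak law of large numbers for the binomial distribution: the expectation of `F(l/N)`
tends to `F(p)` for every `F` bounded on `[0,1]` and continuous at `p`. -/
theorem tendsto_sum_binomial_weight_mul {p : ℝ} (hp : p ∈ Set.Icc (0 : ℝ) 1) {F : ℝ → ℝ} {C : ℝ}
    (hC : ∀ t ∈ Set.Icc (0 : ℝ) 1, |F t| ≤ C) (hF : ContinuousAt F p) :
    Tendsto (fun N : ℕ => ∑ l ∈ Finset.range (N + 1),
      (N.choose l : ℝ) * p ^ l * (1 - p) ^ (N - l) * F ((l : ℝ) / N)) atTop (nhds (F p)) := by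
  have hC0 : 0 ≤ C := (abs_nonneg _).trans (hC p hp)
  have hq : 0 ≤ 1 - p := sub_nonneg.mpr hp.2
  have hp0 : 0 ≤ p := hp.1
  rw [Metric.tendsto_atTop']
  intro ε hε
  obtain ⟨δ, hδ, hFδ⟩ := Metric.continuousAt_iff.mp hF (ε / 2) (half_pos hε)
  have hquad : ∀ t ∈ Set.Icc (0 : ℝ) 1,
      |F t - F p| ≤ ε / 2 + 2 * C / δ ^ 2 * (t - p) ^ 2 := by
    intro t ht
    rcases lt_or_ge |t - p| δ with h | h
    · have h1 := hFδ (x := t) (by rwa [Real.dist_eq])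
      rw [Real.dist_eq] at h1
      have : 0 ≤ 2 * C / δ ^ 2 * (t - p) ^ 2 := by positivity
      linarith
    · have h1 : |F t - F p| ≤ 2 * C := by
        linarith [abs_sub (F t) (F p), hC t ht, hC p hp]
      have h2 : δ ^ 2 ≤ (t - p) ^ 2 := by
        rw [← sq_abs (t - p)]
        gcongr
      have h3 : 2 * C ≤ 2 * C / δ ^ 2 * (t - p) ^ 2 := by
        rw [div_mul_eq_mul_div, le_div_iff₀ (by positivity)]
        gcongr
      linarith
  have herr : Tendsto (fun N : ℕ => 2 * C / δ ^ 2 * (p * (1 - p) / N)) atTop (nhds 0) := by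
    simpa using (tendsto_const_div_atTop_nhds_zero_nat (p * (1 - p))).const_mul (2 * C / δ ^ 2)
  obtain ⟨M, hM⟩ := eventually_atTop.mp (herr.eventually_lt_const (half_pos hε))
  refine ⟨M, fun N hN => ?_⟩
  have hN0 : N ≠ 0 := by omega
  have hdiff : ∑ l ∈ Finset.range (N + 1),
        (N.choose l : ℝ) * p ^ l * (1 - p) ^ (N - l) * F ((l : ℝ) / N) - F p =
      ∑ l ∈ Finset.range (N + 1),
        (N.choose l : ℝ) * p ^ l * (1 - p) ^ (N - l) * (F ((l : ℝ) / N) - F p) := by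
    simp only [mul_sub, Finset.sum_sub_distrib, ← Finset.sum_mul, sum_binomial_weight, one_mul]
  rw [Real.dist_eq, hdiff]
  calc
    _ ≤ ∑ l ∈ Finset.range (N + 1), (N.choose l : ℝ) * p ^ l * (1 - p) ^ (N - l) *
          (ε / 2 + 2 * C / δ ^ 2 * ((l : ℝ) / N - p) ^ 2) := by
      refine (Finset.abs_sum_le_sum_abs _ _).trans (Finset.sum_le_sum fun l hl => ?_)
      have hw : 0 ≤ (N.choose l : ℝ) * p ^ l * (1 - p) ^ (N - l) := by positivity
      rw [abs_mul, abs_of_nonneg hw]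
      refine mul_le_mul_of_nonneg_left (hquad _ ⟨by positivity, ?_⟩) hw
      refine div_le_one_of_le₀ ?_ (by positivity)
      exact_mod_cast Finset.mem_range_succ_iff.mp hl
    _ = ε / 2 + 2 * C / δ ^ 2 * (p * (1 - p) / N) := by
      simp only [mul_add, Finset.sum_add_distrib, ← Finset.sum_mul, sum_binomial_weight, one_mul,
        mul_left_comm _ (2 * C / δ ^ 2), ← Finset.mul_sum, sum_binomial_weight_mul_sq p hN0]
    _ < ε := by linarith [hM N (by omega)]

/-- The normalized entropy of a truncated binomial distribution as an expectation of a
truncated affine function of the frequency `l/N`. -/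
theorem truncated_entropy_eq_sum {p : ℝ} (hp : p ∈ Set.Ioo (0 : ℝ) 1) {x : ℝ}
    (hx : x ∈ Set.Ioo (0 : ℝ) 1) {N : ℕ} (hN : N ≠ 0) :
    (1 / (N : ℝ)) * ∑ l ∈ Finset.range (⌊x * N⌋₊ + 1),
        (N.choose l : ℝ) * p ^ l * (1 - p) ^ (N - l) *
          (-(Real.logb 2 (p ^ l * (1 - p) ^ (N - l)))) =
      ∑ l ∈ Finset.range (N + 1), (N.choose l : ℝ) * p ^ l * (1 - p) ^ (N - l) *
        (Set.Iic x).indicator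
          (fun t => -(t * Real.logb 2 p) - (1 - t) * Real.logb 2 (1 - p)) ((l : ℝ) / N) := by
  have hN' : (0 : ℝ) < N := by positivity
  have hxN : 0 ≤ x * N := mul_nonneg hx.1.le hN'.le
  have hfloor : ⌊x * N⌋₊ ≤ N :=
    Nat.floor_le_of_le (mul_le_of_le_one_left hN'.le hx.2.le)
  rw [← Finset.sum_subset (Finset.range_subset_range.mpr (Nat.succ_le_succ hfloor)), Finset.mul_sum]
  · refine Finset.sum_congr rfl fun l hl => ?_
    have hl' : l ≤ ⌊x * N⌋₊ := Finset.mem_range_succ_iff.mp hl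
    have hmem : (l : ℝ) / N ∈ Set.Iic x :=
      (div_le_iff₀ hN').mpr ((Nat.le_floor_iff hxN).mp hl')
    rw [Set.indicator_of_mem hmem,
      Real.logb_mul (pow_ne_zero _ hp.1.ne') (pow_ne_zero _ (sub_pos.mpr hp.2).ne'),
      Real.logb_pow, Real.logb_pow, Nat.cast_sub (hl'.trans hfloor)]
    field_simp
    ring
  · intro l _ hl
    have hnot : (l : ℝ) / N ∉ Set.Iic x := fun h => hl <| Finset.mem_range_succ_iff.mpr <|
      (Nat.le_floor_iff hxN).mpr ((div_le_iff₀ hN').mp h)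
    rw [Set.indicator_of_notMem hnot, mul_zero]

/-- For `p ∈ (0,1)`, `q = 1 − p` and `x ∈ (0,1)`, the normalized entropy of the truncated
binomial distribution, `(1/N)·∑_{l=0}^{⌊xN⌋} C(N,l) p^l q^{N−l}·(−log₂(p^l q^{N−l}))`,
tends as `N → ∞` to the binary entropy `H(p) = −p log₂ p − q log₂ q` if `x > p`,
and to `0` if `x < p`. -/
theorem truncated_binomial_entropy_limit
    (p : ℝ) (hp : p ∈ Set.Ioo (0 : ℝ) 1) (q : ℝ) (hq : q = 1 - p)
    (x : ℝ) (hx : x ∈ Set.Ioo (0 : ℝ) 1) :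
    (x > p →
      Tendsto (fun N : ℕ => (1 / (N : ℝ)) *
          ∑ l ∈ Finset.range (⌊x * N⌋₊ + 1),
            (N.choose l : ℝ) * p ^ l * q ^ (N - l) *
              (-(Real.logb 2 (p ^ l * q ^ (N - l)))))
        atTop (nhds (-(p * Real.logb 2 p) - q * Real.logb 2 q)))
    ∧
    (x < p →
      Tendsto (fun N : ℕ => (1 / (N : ℝ)) *
          ∑ l ∈ Finset.range (⌊x * N⌋₊ + 1),
            (N.choose l : ℝ) * p ^ l * q ^ (N - l) *
              (-(Real.logb 2 (p ^ l * q ^ (N - l)))))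
        atTop (nhds 0)) := by
  subst hq
  set g : ℝ → ℝ := fun t => -(t * Real.logb 2 p) - (1 - t) * Real.logb 2 (1 - p) with hg
  have hgc : Continuous g := by fun_prop
  obtain ⟨C, hC⟩ := isCompact_Icc.exists_bound_of_continuousOn (s := Set.Icc (0 : ℝ) 1)
    hgc.continuousOn
  have hbound : ∀ t ∈ Set.Icc (0 : ℝ) 1, |(Set.Iic x).indicator g t| ≤ C := fun t ht =>
    (norm_indicator_le_norm_self g t).trans (hC t ht)
  have hlim (hcont : ContinuousAt ((Set.Iic x).indicator g) p) :=
    (tendsto_sum_binomial_weight_mul ⟨hp.1.le, hp.2.le⟩ hbound hcont).congr' <| by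
      filter_upwards [eventually_ne_atTop 0] with N hN
      exact (truncated_entropy_eq_sum hp hx hN).symm
  constructor
  · intro hxp
    have heq : (Set.Iic x).indicator g =ᶠ[nhds p] g := by
      filter_upwards [Iio_mem_nhds hxp] with t ht
      exact Set.indicator_of_mem (Set.mem_Iic.mpr (le_of_lt ht)) g
    simpa only [heq.eq_of_nhds] using hlim (hgc.continuousAt.congr heq.symm)
  · intro hxp
    have heq : (Set.Iic x).indicator g =ᶠ[nhds p] fun _ => 0 := by
      filter_upwards [Ioi_mem_nhds hxp] with t ht
      exact Set.indicator_of_notMem (Set.notMem_Iic.mpr ht) g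
    simpa only [heq.eq_of_nhds] using hlim (continuousAt_const.congr heq.symm)
end
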